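/- Let t ≥ 2 and let G be a graph of order n with vertex degrees d_1, …, d_n and signless Laplacian eigenvalues q_1, …, q_n. Then the multiset of signless Laplacian eigenvalues of the blowup G^(t) equals { tq_1, …, tq_n } together with each of td_1, …, td_n repeated t−1 times. -/

import Mathlib

open Matrix SimpleGraph Finset

/-- The signless Laplacian matrix `Q(G) = D + A` of a finite simple graph `G`. -/
noncomputable def signlessLaplacian {V : Type} [Fintype V] [DecidableEq V]
    (G : SimpleGraph V) : Matrix V V ℝ :=
  letI := Classical.decRel G.Adj
  Matrix.diagonal (fun v => (G.degree v : ℝ)) + G.adjMatrix ℝ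

theorem signlessLaplacian_isHermitian {V : Type} [Fintype V] [DecidableEq V]
    (G : SimpleGraph V) : (signlessLaplacian G).IsHermitian := by
  letI := Classical.decRel G.Adj
  unfold signlessLaplacian
  refine Matrix.IsHermitian.add (Matrix.isHermitian_diagonal _) ?_
  rw [Matrix.IsHermitian, conjTranspose_eq_transpose_of_trivial]
  exact G.isSymm_adjMatrix

/-- `qmin G` is the smallest eigenvalue of the signless Laplacian of `G`. -/
noncomputable def qmin {V : Type} [Fintype V] [DecidableEq V] (G : SimpleGraph V) : ℝ :=
  ⨅ i, (signlessLaplacian_isHermitian G).eigenvalues i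

/-- The multiset of signless Laplacian eigenvalues (with multiplicity) of `G`. -/
noncomputable def qSpectrum {V : Type} [Fintype V] [DecidableEq V]
    (G : SimpleGraph V) : Multiset ℝ :=
  Finset.univ.val.map (signlessLaplacian_isHermitian G).eigenvalues

/-- The blowup `G^(t)`: each vertex `u` of `G` is replaced by `t` independent vertices,
and each edge by a complete bipartite graph between the corresponding sets. -/
def blowup {V : Type} (G : SimpleGraph V) (t : ℕ) : SimpleGraph (V × Fin t) :=
  G.comap Prod.fst

/-- The degree of a vertex, as a real number. -/
noncomputable def degR {V : Type} [Fintype V] (G : SimpleGraph V) (v : V) : ℝ :=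
  letI := Classical.decRel G.Adj
  (G.degree v : ℝ)

theorem Matrix.charpoly_blockDiagonal {m o R : Type*} [CommRing R] [Fintype m] [DecidableEq m]
    [Fintype o] [DecidableEq o] (M : o → Matrix m m R) :
    (blockDiagonal M).charpoly = ∏ k, (M k).charpoly := by
  have h : charmatrix (blockDiagonal M) = blockDiagonal fun k => charmatrix (M k) := by
    ext1 ⟨i, k⟩ ⟨j, l⟩
    by_cases hkl : k = l
    · subst hkl
      simp [charmatrix_apply, blockDiagonal_apply, diagonal_apply]
    · simp [blockDiagonal_apply, hkl]
  simp only [charpoly, h, det_blockDiagonal]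

open Polynomial in
theorem Matrix.roots_charpoly_diagonal {n R : Type*} [CommRing R] [IsDomain R] [Fintype n]
    [DecidableEq n] (d : n → R) : (diagonal d).charpoly.roots = Finset.univ.val.map d := by
  rw [charpoly_diagonal, roots_prod _ _ (Finset.prod_ne_zero_iff.2 fun i _ => X_sub_C_ne_zero _)]
  simp only [roots_X_sub_C, Multiset.bind_singleton]

theorem Matrix.charpoly_conj_of_mul_eq_one {n R : Type*} [CommRing R] [Fintype n] [DecidableEq n]
    {U W : Matrix n n R} (h : W * U = 1) (M : Matrix n n R) :
    (U * M * W).charpoly = M.charpoly := by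
  rw [charpoly_mul_comm, ← mul_assoc, h, one_mul]

theorem Matrix.IsHermitian.exists_eq_mul_diagonal_mul {n : Type*} [Fintype n] [DecidableEq n]
    {A : Matrix n n ℝ} (hA : A.IsHermitian) :
    ∃ U W : Matrix n n ℝ, W * U = 1 ∧ A = U * diagonal hA.eigenvalues * W :=
  ⟨hA.eigenvectorUnitary, star (hA.eigenvectorUnitary : Matrix n n ℝ),
    Unitary.coe_star_mul_self _, by
      conv_lhs => rw [hA.spectral_theorem, Unitary.conjStarAlgAut_apply]
      rfl⟩

theorem Matrix.IsHermitian.roots_charpoly_smul {n : Type*} [Fintype n] [DecidableEq n]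
    {A : Matrix n n ℝ} (hA : A.IsHermitian) (c : ℝ) :
    (c • A).charpoly.roots = Finset.univ.val.map fun i => c * hA.eigenvalues i := by
  obtain ⟨U, W, hWU, h⟩ := hA.exists_eq_mul_diagonal_mul
  have hc : c • A = U * diagonal (fun i => c * hA.eigenvalues i) * W := by
    conv_lhs => rw [h]
    rw [← Matrix.smul_mul, ← Matrix.mul_smul, ← diagonal_smul]
    rfl
  rw [hc, charpoly_conj_of_mul_eq_one hWU, roots_charpoly_diagonal]

open Kronecker in
/-- Diagonalizing the right factor block-diagonalizes `A ⊗ J + B ⊗ 1`. -/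
theorem Matrix.IsHermitian.charpoly_kronecker_add_kronecker_one {m n : Type*} [Fintype m]
    [DecidableEq m] [Fintype n] [DecidableEq n] (A B : Matrix m m ℝ) {J : Matrix n n ℝ}
    (hJ : J.IsHermitian) :
    (A ⊗ₖ J + B ⊗ₖ (1 : Matrix n n ℝ)).charpoly =
      (J.charpoly.roots.map fun c => (c • A + B).charpoly).prod := by
  obtain ⟨U, W, hWU, h⟩ := hJ.exists_eq_mul_diagonal_mul
  have hUW : U * W = 1 := mul_eq_one_comm.1 hWU
  have hblock : A ⊗ₖ J + B ⊗ₖ (1 : Matrix n n ℝ) =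
      ((1 : Matrix m m ℝ) ⊗ₖ U) * blockDiagonal (fun k => hJ.eigenvalues k • A + B) *
        ((1 : Matrix m m ℝ) ⊗ₖ W) := by
    have hsplit : blockDiagonal (fun k => hJ.eigenvalues k • A + B) =
        A ⊗ₖ diagonal hJ.eigenvalues + B ⊗ₖ (1 : Matrix n n ℝ) := by
      ext ⟨i, k⟩ ⟨j, l⟩
      by_cases hkl : k = l
      · subst hkl
        simp [blockDiagonal_apply, mul_comm]
      · simp [blockDiagonal_apply, hkl]
    rw [hsplit, mul_add, add_mul]
    simp only [← mul_kronecker_mul, one_mul, mul_one, hUW, ← h]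
  rw [hblock, charpoly_conj_of_mul_eq_one (by simp [← mul_kronecker_mul, hWU]),
    charpoly_blockDiagonal, hJ.roots_charpoly_eq_eigenvalues, Multiset.map_map]
  rfl

open Polynomial in
theorem Matrix.roots_charpoly_vecMulVec_one (s : ℕ) :
    (vecMulVec (1 : Fin (s + 1) → ℝ) 1).charpoly.roots =
      ((s + 1 : ℕ) : ℝ) ::ₘ Multiset.replicate s 0 := by
  have h : (vecMulVec (1 : Fin (s + 1) → ℝ) 1).charpoly =
      (X - C ((s + 1 : ℕ) : ℝ)) * X ^ s := by
    rw [charpoly_vecMulVec]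
    simp [pow_succ, smul_eq_C_mul]
    ring
  rw [h, roots_mul (mul_ne_zero (X_sub_C_ne_zero _) (pow_ne_zero _ X_ne_zero)), roots_X_sub_C,
    roots_X_pow, Multiset.nsmul_singleton, Multiset.singleton_add]

theorem signlessLaplacian_eq {V : Type} [Fintype V] [DecidableEq V] (G : SimpleGraph V)
    [DecidableRel G.Adj] :
    signlessLaplacian G = diagonal (degR G) + G.adjMatrix ℝ := by
  unfold signlessLaplacian degR
  congr!

theorem degR_blowup {V : Type} [Fintype V] (G : SimpleGraph V) (t : ℕ) (v : V × Fin t) :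
    degR (blowup G t) v = t * degR G v.1 := by
  classical
  have h : (blowup G t).neighborFinset v = G.neighborFinset v.1 ×ˢ Finset.univ := by
    ext w
    rw [mem_neighborFinset]
    simp [blowup]
  have hcard : (blowup G t).degree v = t * G.degree v.1 := by
    rw [← card_neighborFinset_eq_degree, h, Finset.card_product, Finset.card_univ,
      Fintype.card_fin, card_neighborFinset_eq_degree, mul_comm]
  have := congrArg (Nat.cast (R := ℝ)) hcard
  push_cast at this
  unfold degR
  convert this

open Kronecker in
theorem signlessLaplacian_blowup {V : Type} [Fintype V] [DecidableEq V] (G : SimpleGraph V)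
    [DecidableRel G.Adj] (t : ℕ) :
    signlessLaplacian (blowup G t) =
      G.adjMatrix ℝ ⊗ₖ vecMulVec (1 : Fin t → ℝ) 1 +
        diagonal (fun v => (t : ℝ) * degR G v) ⊗ₖ (1 : Matrix (Fin t) (Fin t) ℝ) := by
  classical
  rw [signlessLaplacian_eq, add_comm]
  congr 1
  · ext ⟨u, i⟩ ⟨v, j⟩
    rw [adjMatrix_apply]
    simp [blowup, adjMatrix_apply]
  · rw [← diagonal_one, diagonal_kronecker_diagonal]
    congr 1
    ext v
    simp [degR_blowup]

/-- For `t ≥ 2`, the signless Laplacian eigenvalues of the blowup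
`G^(t)` are `tq₁, …, tqₙ` together with each of `td₁, …, tdₙ` repeated `t - 1` times. -/
theorem qSpectrum_blowup {V : Type} [Fintype V] [DecidableEq V]
    (G : SimpleGraph V) (t : ℕ) (ht : 2 ≤ t) :
    qSpectrum (blowup G t) =
      Finset.univ.val.map (fun i => (t : ℝ) * (signlessLaplacian_isHermitian G).eigenvalues i) +
      (t - 1) • Finset.univ.val.map (fun v : V => (t : ℝ) * degR G v) := by
  classical
  have hJ : (vecMulVec (1 : Fin t → ℝ) 1).IsHermitian := by
    ext i j
    simp [vecMulVec_apply]
  have hQ : (t : ℝ) • G.adjMatrix ℝ + diagonal (fun v => (t : ℝ) * degR G v) =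
      (t : ℝ) • signlessLaplacian G := by
    rw [signlessLaplacian_eq, smul_add, add_comm, ← diagonal_smul]
    rfl
  have hspec : qSpectrum (blowup G t) = (signlessLaplacian (blowup G t)).charpoly.roots :=
    (signlessLaplacian_isHermitian _).roots_charpoly_eq_eigenvalues.symm
  rw [hspec, signlessLaplacian_blowup, hJ.charpoly_kronecker_add_kronecker_one]
  obtain ⟨s, rfl⟩ : ∃ s, t = s + 1 := ⟨t - 1, by omega⟩
  rw [roots_charpoly_vecMulVec_one, Multiset.map_cons, Multiset.map_replicate,
    Multiset.prod_cons, Multiset.prod_replicate, zero_smul, zero_add, hQ,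
    Polynomial.roots_mul (mul_ne_zero (charpoly_monic _).ne_zero
      (pow_ne_zero _ (charpoly_monic _).ne_zero)),
    Polynomial.roots_pow, roots_charpoly_diagonal, (signlessLaplacian_isHermitian G).roots_charpoly_smul,
    Nat.add_sub_cancel]
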